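/- Fix P and D with 0 < P < D < 1/2, and let υ = √(1 + P² − 2D). Then the function D' ↦ ħ(D', P) is differentiable at D with derivative (1/(2υ))·log((1 − P + υ)/(1 + P − υ)). -/

import Mathlib

/-- The binary entropy function (natural logarithm, `Real.log 0 = 0`). -/
noncomputable def Hb (a : ℝ) : ℝ :=
  -(a * Real.log a) - (1 - a) * Real.log (1 - a)

/-- The function `ħ(D,P)` from the paper. -/
noncomputable def hbar (D P : ℝ) : ℝ :=
  if D < 1 / 2 then
    Hb ((1 + min D P - Real.sqrt (1 + (min D P) ^ 2 - 2 * D)) / 2)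
  else Real.log 2

theorem Hb_eq_binEntropy : Hb = Real.binEntropy := by
  funext a
  rw [Hb, Real.binEntropy, Real.log_inv, Real.log_inv]
  ring

theorem hbar_eq_of_le {D P : ℝ} (hPD : P ≤ D) (hD : D < 1 / 2) :
    hbar D P = Hb ((1 + P - Real.sqrt (1 + P ^ 2 - 2 * D)) / 2) := by
  rw [hbar, if_pos hD, min_eq_right hPD]

/-- For `0 < P < D < 1/2`, the partial derivative of `ħ` in `D` is
`(1/(2υ))·log((1−P+υ)/(1+P−υ))` with `υ = √(1+P²−2D)`. -/
theorem hbar_hasDerivAt_fst (D P : ℝ) (hP : 0 < P) (hPD : P < D) (hD : D < 1 / 2) :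
    HasDerivAt (fun D' => hbar D' P)
      ((1 / (2 * Real.sqrt (1 + P ^ 2 - 2 * D))) *
        Real.log ((1 - P + Real.sqrt (1 + P ^ 2 - 2 * D)) /
          (1 + P - Real.sqrt (1 + P ^ 2 - 2 * D)))) D := by
  have hEq : (fun D' => hbar D' P) =ᶠ[nhds D]
      fun D' => Real.binEntropy ((1 + P - Real.sqrt (1 + P ^ 2 - 2 * D')) / 2) := by
    filter_upwards [Ioo_mem_nhds hPD hD] with x hx
    rw [hbar_eq_of_le hx.1.le hx.2, Hb_eq_binEntropy]
  have hrad : 0 < 1 + P ^ 2 - 2 * D := by nlinarith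
  have hlin : HasDerivAt (fun x : ℝ => 1 + P ^ 2 - 2 * x) (-2) D := by
    simpa using ((hasDerivAt_id D).const_mul 2).const_sub (1 + P ^ 2)
  have hsqrt := ((hlin.sqrt hrad.ne').const_sub (1 + P)).div_const 2
  have hpos : 0 < Real.sqrt (1 + P ^ 2 - 2 * D) := Real.sqrt_pos.2 hrad
  have hlt : Real.sqrt (1 + P ^ 2 - 2 * D) < 1 := by
    rw [Real.sqrt_lt' one_pos]
    nlinarith
  have hent := Real.hasDerivAt_binEntropy
    (p := (1 + P - Real.sqrt (1 + P ^ 2 - 2 * D)) / 2) (by linarith) (by linarith)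
  refine ((hent.comp D hsqrt).congr_of_eventuallyEq hEq).congr_deriv ?_
  generalize Real.sqrt (1 + P ^ 2 - 2 * D) = v at hpos hlt ⊢
  rw [← Real.log_div (by linarith) (by linarith),
    show (1 - (1 + P - v) / 2) / ((1 + P - v) / 2) = (1 - P + v) / (1 + P - v) by
      rw [show 1 - (1 + P - v) / 2 = (1 - P + v) / 2 by ring,
        div_div_div_cancel_right₀ two_ne_zero]]
  field_simp
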